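/- Let K be a field and G a finite simple graph on [n]. Then depth(S/J_G) ≥ 4r + Σ_{i=1}^{n} r_i (i + 1), where r is the number of connected components of G that are not complete graphs, and r_i is the number of connected components of G that are complete graphs on exactly i vertices, for 1 ≤ i ≤ n. -/

import Mathlib

open MvPolynomial

noncomputable section

/-- The binomial edge ideal of a simple graph `G` on vertex set `V`, inside
`K[x_v, y_v : v ∈ V] = MvPolynomial (V ⊕ V) K`. -/
def binomialEdgeIdeal (K : Type) [Field K] {V : Type} (G : SimpleGraph V) :
    Ideal (MvPolynomial (V ⊕ V) K) :=
  Ideal.span {f | ∃ i j, G.Adj i j ∧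
    f = X (Sum.inl i) * X (Sum.inr j) - X (Sum.inl j) * X (Sum.inr i)}

/-- The depth (with respect to the graded maximal ideal) of the quotient `S/I`
of a polynomial ring `S = MvPolynomial σ K`, as an `S`-module. -/
def quotientDepth {σ K : Type} [Field K] (I : Ideal (MvPolynomial σ K)) : ℕ :=
  sSup {d : ℕ | ∃ rs : List (MvPolynomial σ K), rs.length = d ∧
    (∀ r ∈ rs, constantCoeff r = 0) ∧
    RingTheory.Sequence.IsRegular (MvPolynomial σ K ⧸ I) rs}

/-- A connected component of `G` is complete if any two distinct vertices in
it are adjacent in `G`. -/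
def IsCompleteComponent {V : Type} {G : SimpleGraph V}
    (c : G.ConnectedComponent) : Prop :=
  ∀ u ∈ c.supp, ∀ v ∈ c.supp, u ≠ v → G.Adj u v

open CategoryTheory Abelian RingTheory.Sequence in
/-- Ext-vanishing form of `depth ≥ k`. -/
def DGe {R : Type} [CommRing R] (m : Ideal R) (M : Type) [AddCommGroup M] [Module R M]
    (k : ℕ) : Prop :=
  ∀ i < k, Subsingleton (Ext (ModuleCat.of R (R ⧸ m)) (ModuleCat.of R M) i)

section DepthTheory

open CategoryTheory Abelian RingTheory.Sequence

variable {R : Type} [CommRing R] {m : Ideal R}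

lemma DGe.mono {M : Type} [AddCommGroup M] [Module R M] {k l : ℕ} (h : DGe m M k) (hl : l ≤ k) :
    DGe m M l := fun i hi => h i (by omega)

lemma sesOf {A B C : Type} [AddCommGroup A] [Module R A] [AddCommGroup B] [Module R B]
    [AddCommGroup C] [Module R C] (f : A →ₗ[R] B) (g : B →ₗ[R] C)
    (hf : Function.Injective f) (hg : Function.Surjective g) (hfg : Function.Exact f g) :
    (ModuleCat.shortComplexOfCompEqZero f g hfg.linearMap_comp_eq_zero).ShortExact where
  exact := ModuleCat.shortComplex_exact _ hfg
  mono_f := by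
    simpa [ModuleCat.shortComplexOfCompEqZero, ModuleCat.mono_iff_injective] using hf
  epi_g := by
    simpa [ModuleCat.shortComplexOfCompEqZero, ModuleCat.epi_iff_surjective] using hg

lemma DGe.left {A B C : Type} [AddCommGroup A] [Module R A] [AddCommGroup B] [Module R B]
    [AddCommGroup C] [Module R C] (f : A →ₗ[R] B) (g : B →ₗ[R] C)
    (hf : Function.Injective f) (hg : Function.Surjective g) (hfg : Function.Exact f g)
    {k : ℕ} (hB : DGe m B k) (hC : DGe m C (k - 1)) : DGe m A k := by
  intro i hi
  have ses := sesOf f g hf hg hfg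
  refine subsingleton_of_forall_eq 0 fun x => ?_
  have hB' := hB i hi
  have hx : x.comp (Ext.mk₀ (ModuleCat.ofHom f)) (add_zero i) = 0 := hB'.elim _ _
  rcases i with _ | i
  · have : Mono (ModuleCat.ofHom f) := by simpa [ModuleCat.mono_iff_injective] using hf
    apply Ext.postcomp_mk₀_injective_of_mono (ModuleCat.of R (R ⧸ m)) (ModuleCat.ofHom f)
    simpa using hx
  · obtain ⟨y, rfl⟩ := Ext.covariant_sequence_exact₁ _ ses x hx (n₀ := i) rfl
    have : y = 0 := (hC i (by omega)).elim _ _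
    subst this
    simp

lemma DGe.mid {A B C : Type} [AddCommGroup A] [Module R A] [AddCommGroup B] [Module R B]
    [AddCommGroup C] [Module R C] (f : A →ₗ[R] B) (g : B →ₗ[R] C)
    (hf : Function.Injective f) (hg : Function.Surjective g) (hfg : Function.Exact f g)
    {k : ℕ} (hA : DGe m A k) (hC : DGe m C k) : DGe m B k := by
  intro i hi
  have ses := sesOf f g hf hg hfg
  refine subsingleton_of_forall_eq 0 fun x => ?_
  have hx : x.comp (Ext.mk₀ (ModuleCat.ofHom g)) (add_zero i) = 0 := (hC i hi).elim _ _
  obtain ⟨y, rfl⟩ := Ext.covariant_sequence_exact₂ _ ses x hx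
  have : y = 0 := (hA i hi).elim _ _
  subst this
  simp

/-- regular element: `f` is multiplication by `x ∈ m` -/
lemma DGe.reg {A C : Type} [AddCommGroup A] [Module R A] 
    [AddCommGroup C] [Module R C] (x : R) (hx : x ∈ m) (g : A →ₗ[R] C)
    (hf : Function.Injective (LinearMap.lsmul R A x)) (hg : Function.Surjective g)
    (hfg : Function.Exact (LinearMap.lsmul R A x) g)
    {k : ℕ} (hC : DGe m C k) : DGe m A (k + 1) := by
  intro i hi
  have ses := sesOf _ g hf hg hfg
  refine subsingleton_of_forall_eq 0 fun e => ?_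
  have h0 : e.comp (Ext.mk₀ (ModuleCat.ofHom (LinearMap.lsmul R A x))) (add_zero i) = 0 := by
    have h1 := Ext.postcomp_smul_id_eq_zero_of_mem_annihilator (R := R)
      (M := ModuleCat.of R A) (N := ModuleCat.of R (R ⧸ m)) (r := x)
      (by simpa [Ideal.annihilator_quotient] using hx) i
    have h2 := congrArg (fun t => t.hom e) h1
    simp at h2
    exact h2
  rcases i with _ | i
  · have : Mono (ModuleCat.ofHom (LinearMap.lsmul R A x)) := by
      rw [ModuleCat.mono_iff_injective]; exact hf
    apply Ext.postcomp_mk₀_injective_of_mono (ModuleCat.of R (R ⧸ m))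
      (ModuleCat.ofHom (LinearMap.lsmul R A x))
    simpa using h0
  · obtain ⟨y, rfl⟩ := Ext.covariant_sequence_exact₁ _ ses e h0 (n₀ := i) rfl
    have : y = 0 := (hC i (by omega)).elim _ _
    subst this
    simp

/-- `0 → R/J → R/I → R/(I+y) → 0` maps -/
lemma colon_data (I J : Ideal R) (y : R) (h : ∀ a, y * a ∈ I ↔ a ∈ J) :
    ∃ (f : (R ⧸ J) →ₗ[R] (R ⧸ I)) (g : (R ⧸ I) →ₗ[R] (R ⧸ (I ⊔ Ideal.span {y}))),
      (∀ a : R, f (Submodule.Quotient.mk a) = Submodule.Quotient.mk (y * a)) ∧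
      Function.Injective f ∧ Function.Surjective g ∧ Function.Exact f g := by
  refine ⟨Submodule.mapQ J I (LinearMap.lsmul R R y) (fun a ha => (h a).2 ha),
    Submodule.mapQ I _ LinearMap.id (fun a ha => Ideal.mem_sup_left ha), fun a => rfl, ?_, ?_, ?_⟩
  · rw [← LinearMap.ker_eq_bot, LinearMap.ker_eq_bot']
    intro a
    obtain ⟨a, rfl⟩ := Submodule.Quotient.mk_surjective _ a
    intro ha
    replace ha : (Submodule.Quotient.mk (y * a) : R ⧸ I) = 0 := ha
    rw [Submodule.Quotient.mk_eq_zero] at ha ⊢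
    exact (h a).1 ha
  · intro a
    obtain ⟨a, rfl⟩ := Submodule.Quotient.mk_surjective _ a
    exact ⟨Submodule.Quotient.mk a, rfl⟩
  · intro a
    obtain ⟨a, rfl⟩ := Submodule.Quotient.mk_surjective _ a
    simp only [Submodule.mapQ_apply, LinearMap.id_apply, Submodule.Quotient.mk_eq_zero, Set.mem_range]
    constructor
    · intro ha
      obtain ⟨i, hi, z, hz, rfl⟩ := Submodule.mem_sup.1 ha
      obtain ⟨b, rfl⟩ := Ideal.mem_span_singleton'.1 hz
      refine ⟨Submodule.Quotient.mk b, ?_⟩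
      change (Submodule.Quotient.mk (y * b) : R ⧸ I) = _
      rw [Submodule.Quotient.eq]
      have : y * b - (i + b * y) = - i := by ring
      rw [this]; exact I.neg_mem hi
    · rintro ⟨b, hb⟩
      obtain ⟨b, rfl⟩ := Submodule.Quotient.mk_surjective _ b
      change (Submodule.Quotient.mk (y * b) : R ⧸ I) = _ at hb
      rw [Submodule.Quotient.eq] at hb
      have : a = -(y * b - a) + b * y := by ring
      rw [this]
      exact Ideal.add_mem _ (Ideal.mem_sup_left (I.neg_mem hb))
        (Ideal.mem_sup_right (Ideal.mem_span_singleton'.2 ⟨b, rfl⟩))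

lemma DGe.colon {I J : Ideal R} {y : R} (h : ∀ a, y * a ∈ I ↔ a ∈ J) {k : ℕ}
    (hJ : DGe m (R ⧸ J) k) (hI : DGe m (R ⧸ (I ⊔ Ideal.span {y})) k) : DGe m (R ⧸ I) k := by
  obtain ⟨f, g, -, hf, hg, hfg⟩ := colon_data I J y h
  exact DGe.mid f g hf hg hfg hJ hI

lemma DGe.regular {I : Ideal R} {x : R} (hx : x ∈ m) (h : ∀ a, x * a ∈ I → a ∈ I) {k : ℕ}
    (hI : DGe m (R ⧸ (I ⊔ Ideal.span {x})) k) : DGe m (R ⧸ I) (k + 1) := by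
  obtain ⟨f, g, hf', hf, hg, hfg⟩ :=
    colon_data I I x (fun a => ⟨h a, fun ha => I.mul_mem_left _ ha⟩)
  have : f = LinearMap.lsmul R (R ⧸ I) x := by
    ext
    have := hf' 1
    rw [mul_one] at this
    rw [show (x : R) = x • (1 : R) by simp] at this
    exact this
  subst this
  exact DGe.reg x hx g hf hg hfg hI

lemma DGe.inter {A B I : Ideal R} (hI : ∀ a, a ∈ I ↔ a ∈ A ∧ a ∈ B) {k : ℕ}
    (hA : DGe m (R ⧸ A) k) (hB : DGe m (R ⧸ B) k) (hAB : DGe m (R ⧸ (A ⊔ B)) (k - 1)) :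
    DGe m (R ⧸ I) k := by
  have hIA : I ≤ A := fun a ha => ((hI a).1 ha).1
  have hIB : I ≤ B := fun a ha => ((hI a).1 ha).2
  let p : (R ⧸ I) →ₗ[R] (R ⧸ B) := Submodule.mapQ I B LinearMap.id hIB
  let q : (R ⧸ I) →ₗ[R] (R ⧸ A) := Submodule.mapQ I A LinearMap.id hIA
  let s : (R ⧸ A) →ₗ[R] (R ⧸ (A ⊔ B)) := Submodule.mapQ A _ LinearMap.id 
    (show A ≤ A ⊔ B from le_sup_left)
  have hp : Function.Surjective p := fun a => by
    obtain ⟨a, rfl⟩ := Submodule.Quotient.mk_surjective _ a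
    exact ⟨Submodule.Quotient.mk a, rfl⟩
  have hs : Function.Surjective s := fun a => by
    obtain ⟨a, rfl⟩ := Submodule.Quotient.mk_surjective _ a
    exact ⟨Submodule.Quotient.mk a, rfl⟩
  have hN : DGe m (LinearMap.ker p) k := by
    refine DGe.left (q.comp (LinearMap.ker p).subtype) s ?_ hs ?_ hA hAB
    · rw [← LinearMap.ker_eq_bot, LinearMap.ker_eq_bot']
      rintro ⟨a, ha⟩ h
      obtain ⟨a, rfl⟩ := Submodule.Quotient.mk_surjective _ a
      simp only [p, q, LinearMap.mem_ker, Submodule.mapQ_apply, LinearMap.comp_apply, 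
        Submodule.subtype_apply, LinearMap.id_apply, Submodule.Quotient.mk_eq_zero] at ha h
      ext
      exact (Submodule.Quotient.mk_eq_zero I).2 ((hI a).2 ⟨h, ha⟩)
    · intro a
      obtain ⟨a, rfl⟩ := Submodule.Quotient.mk_surjective _ a
      simp only [s, Submodule.mapQ_apply, LinearMap.id_apply, Submodule.Quotient.mk_eq_zero,
        Set.mem_range]
      constructor
      · intro ha
        obtain ⟨i, hi, b, hb, rfl⟩ := Submodule.mem_sup.1 ha
        refine ⟨⟨Submodule.Quotient.mk b, ?_⟩, ?_⟩
        · exact (Submodule.Quotient.mk_eq_zero B).2 hb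
        · simp only [q, LinearMap.comp_apply, Submodule.subtype_apply, Submodule.mapQ_apply, 
            LinearMap.id_apply]
          rw [Submodule.Quotient.eq]
          simpa using hi
      · rintro ⟨⟨b, hb⟩, h⟩
        obtain ⟨b, rfl⟩ := Submodule.Quotient.mk_surjective _ b
        simp only [p, q, LinearMap.mem_ker, Submodule.mapQ_apply, LinearMap.comp_apply, 
          Submodule.subtype_apply, LinearMap.id_apply, Submodule.Quotient.mk_eq_zero] at hb h
        rw [Submodule.Quotient.eq] at h
        have : a = -(b - a) + b := by ring
        rw [this]
        exact Ideal.add_mem _ (Ideal.mem_sup_left (A.neg_mem h)) (Ideal.mem_sup_right hb)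
  refine DGe.mid (LinearMap.ker p).subtype p (Submodule.subtype_injective _) hp ?_ hN hB
  exact LinearMap.exact_subtype_ker_map p

lemma DGe.exists_regular [IsNoetherianRing R] {I : Ideal R} (hI : I ≤ m) (hm : m ≠ ⊤) {k : ℕ}
    (h : DGe m (R ⧸ I) k) :
    ∃ rs : List R, rs.length = k ∧ (∀ r ∈ rs, r ∈ m) ∧ IsRegular (R ⧸ I) rs := by
  refine ModuleCat.exists_isRegular_of_exists_subsingleton_ext m k (ModuleCat.of R (R ⧸ I)) ?_ 
    (ModuleCat.of R (R ⧸ m)) ?_ h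
  · rw [lt_top_iff_ne_top]
    intro h
    apply hm
    have h1 := congrArg (Submodule.comap (Submodule.mkQ I)) h
    rw [Ideal.eq_top_iff_one]
    have h2 : (Submodule.mkQ I 1) ∈ m • (⊤ : Submodule R (R ⧸ I)) := by
      rw [show m • (⊤ : Submodule R (R ⧸ I)) = ⊤ from h]; trivial
    have h3 : m • (⊤ : Submodule R (R ⧸ I)) ≤ Submodule.map (Submodule.mkQ I) m := by
      rw [Submodule.smul_le]
      rintro r hr n -
      obtain ⟨n, rfl⟩ := Submodule.Quotient.mk_surjective _ n
      exact ⟨r * n, m.mul_mem_right _ hr, rfl⟩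
    obtain ⟨a, ha, ha'⟩ := h3 h2
    have h4 : a - 1 ∈ I := (Submodule.Quotient.eq I).1 ha'
    have : (1 : R) = a - (a - 1) := by ring
    rw [this]
    exact m.sub_mem ha (hI h4)
  · rw [show Module.support R (ModuleCat.of R (R ⧸ m)) = _ from Module.support_eq_zeroLocus, 
      Ideal.annihilator_quotient]

lemma length_le_supportDim [IsNoetherianRing R] (rs : List R) (M : Type) [AddCommGroup M]
    [Module R M] [Module.Finite R M] (h : IsRegular M rs) :
    (rs.length : WithBot ℕ∞) ≤ Module.supportDim R M := by
  induction rs generalizing M with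
  | nil => 
    have := h.nontrivial
    have h1 := Module.supportDim_ne_bot_of_nontrivial R M
    obtain ⟨a, ha⟩ := WithBot.ne_bot_iff_exists.1 h1
    rw [← ha]
    simp
  | cons r rs ih =>
    rw [isRegular_cons_iff] at h
    have h1 := ih (QuotSMulTop r M) h.2
    refine le_trans ?_ (Module.supportDim_quotSMulTop_succ_le_of_notMem_minimalPrimes
      (x := r) (fun p hp => h.1.notMem_of_mem_minimalPrimes hp))
    push_cast [List.length_cons]
    gcongr

end DepthTheory
section Toric

open MvPolynomial

variable {K : Type} [Field K] {V : Type}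

/-- the binomial of a pair -/
def eb (K : Type) [Field K] {V : Type} (i j : V) : MvPolynomial (V ⊕ V) K :=
  X (Sum.inl i) * X (Sum.inr j) - X (Sum.inl j) * X (Sum.inr i)

/-- variables in `Z` together with the binomial edge ideal -/
def KI (K : Type) [Field K] {V : Type} (Z : Set (V ⊕ V)) (G : SimpleGraph V) :
    Ideal (MvPolynomial (V ⊕ V) K) :=
  Ideal.span ((X '' Z) ∪ {f | ∃ i j, G.Adj i j ∧ f = eb K i j})

lemma KI_le_iff {Z : Set (V ⊕ V)} {G : SimpleGraph V} {I : Ideal (MvPolynomial (V ⊕ V) K)} :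
    KI K Z G ≤ I ↔ (∀ z ∈ Z, X z ∈ I) ∧ ∀ i j, G.Adj i j → eb K i j ∈ I := by
  rw [KI, Ideal.span_le]
  constructor
  · intro h
    exact ⟨fun z hz => h (Or.inl ⟨z, hz, rfl⟩), fun i j hij => h (Or.inr ⟨i, j, hij, rfl⟩)⟩
  · rintro ⟨h1, h2⟩ f (⟨z, hz, rfl⟩ | ⟨i, j, hij, rfl⟩)
    · exact h1 z hz
    · exact h2 i j hij

lemma X_mem_KI {Z : Set (V ⊕ V)} {G : SimpleGraph V} {z : V ⊕ V} (hz : z ∈ Z) :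
    (X z : MvPolynomial (V ⊕ V) K) ∈ KI K Z G := (KI_le_iff.1 le_rfl).1 z hz

lemma eb_mem_KI {Z : Set (V ⊕ V)} {G : SimpleGraph V} {i j : V} (h : G.Adj i j) :
    eb K i j ∈ KI K Z G := (KI_le_iff.1 le_rfl).2 i j h

lemma KI_empty (G : SimpleGraph V) : KI K ∅ G = binomialEdgeIdeal K G := by
  simp [KI, binomialEdgeIdeal, eb]

/-- kill the variables in `Z` -/
def kill (K : Type) [Field K] {V : Type} (Z : Set (V ⊕ V)) :
    MvPolynomial (V ⊕ V) K →ₐ[K] MvPolynomial (V ⊕ V) K :=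
  open Classical in aeval (fun z => if z ∈ Z then 0 else X z)

lemma kill_of_mem {Z : Set (V ⊕ V)} {z : V ⊕ V} (h : z ∈ Z) : kill K Z (X z) = 0 := by
  simp [kill, h]

lemma kill_of_notMem {Z : Set (V ⊕ V)} {z : V ⊕ V} (h : z ∉ Z) : kill K Z (X z) = X z := by
  simp [kill, h]

lemma sub_kill_mem (Z : Set (V ⊕ V)) (f : MvPolynomial (V ⊕ V) K) :
    f - kill K Z f ∈ Ideal.span (X '' Z : Set (MvPolynomial (V ⊕ V) K)) := by
  set Q := Ideal.span (X '' Z : Set (MvPolynomial (V ⊕ V) K))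
  have h : (Ideal.Quotient.mkₐ K Q).comp (kill K Z) = Ideal.Quotient.mkₐ K Q := by
    apply MvPolynomial.algHom_ext
    intro z
    by_cases hz : z ∈ Z
    · simp only [AlgHom.comp_apply, kill_of_mem hz, map_zero]
      symm
      exact Ideal.Quotient.eq_zero_iff_mem.2 (Ideal.subset_span ⟨z, hz, rfl⟩)
    · simp [kill_of_notMem hz]
  have h2 := DFunLike.congr_fun h f
  exact Ideal.Quotient.eq.1 h2.symm

variable [Fintype V]

open Classical in
/-- exponent weights -/
def tw (G : SimpleGraph V) : V ⊕ V → (V ⊕ V →₀ ℕ)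
  | Sum.inl i => Finsupp.equivFunOnFinite.symm
      (Sum.elim (fun k => if k = i then 1 else 0) (fun k => if k = i ∨ G.Adj k i then 1 else 0))
  | Sum.inr i => Finsupp.equivFunOnFinite.symm
      (Sum.elim (fun k => if k = i then 1 else 0) (fun _ => 0))

/-- exponent map -/
def tF (G : SimpleGraph V) (m : V ⊕ V →₀ ℕ) : V ⊕ V →₀ ℕ := ∑ z, m z • tw G z

lemma tF_add (G : SimpleGraph V) (m n : V ⊕ V →₀ ℕ) : tF G (m + n) = tF G m + tF G n := by
  simp [tF, add_smul, Finset.sum_add_distrib]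

lemma tF_single (G : SimpleGraph V) (z : V ⊕ V) : tF G (Finsupp.single z 1) = tw G z := by
  classical
  simp [tF, Finsupp.single_apply, ite_smul]

lemma tF_inl (G : SimpleGraph V) (m : V ⊕ V →₀ ℕ) (i : V) :
    tF G m (Sum.inl i) = m (Sum.inl i) + m (Sum.inr i) := by
  classical
  simp [tF, tw, Finsupp.finsetSum_apply]

open Classical in
lemma tF_inr (G : SimpleGraph V) (m : V ⊕ V →₀ ℕ) (k : V) :
    tF G m (Sum.inr k) = ∑ i with (k = i ∨ G.Adj k i), m (Sum.inl i) := by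
  simp [tF, tw, Finsupp.finsetSum_apply, Finset.sum_filter]

/-- toric map -/
def tphi (K : Type) [Field K] (G : SimpleGraph V) :
    MvPolynomial (V ⊕ V) K →ₐ[K] MvPolynomial (V ⊕ V) K :=
  aeval (fun z => monomial (tw G z) 1)

lemma tphi_monomial (G : SimpleGraph V) (m : V ⊕ V →₀ ℕ) (c : K) :
    tphi K G (monomial m c) = monomial (tF G m) c := by
  rw [tphi, aeval_monomial, Finsupp.prod_fintype _ _ (by simp), tF, monomial_sum_index]
  simp [monomial_pow]

/-- `G` is a disjoint union of cliques -/
def Tr (G : SimpleGraph V) : Prop := ∀ i j k, G.Adj i j → G.Adj j k → i ≠ k → G.Adj i k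

lemma tw_swap {G : SimpleGraph V} (hG : Tr G) {i j : V} (h : G.Adj i j) :
    tw G (Sum.inl i) + tw G (Sum.inr j) = tw G (Sum.inl j) + tw G (Sum.inr i) := by
  classical
  ext z
  rcases z with k | k
  · simp [tw, add_comm]
  · have : (k = i ∨ G.Adj k i) ↔ (k = j ∨ G.Adj k j) := by
      constructor
      · rintro (rfl | h')
        · exact Or.inr h
        · by_cases hk : k = j
          · exact Or.inl hk
          · exact Or.inr (hG _ _ _ h' h hk)
      · rintro (rfl | h')
        · exact Or.inr h.symm
        · by_cases hk : k = i
          · exact Or.inl hk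
          · exact Or.inr (hG _ _ _ h' h.symm hk)
    simp [tw, this]

lemma monomial_congr {G : SimpleGraph V} (hG : Tr G) (m' : V ⊕ V →₀ ℕ) (N : ℕ) :
    ∀ m : V ⊕ V →₀ ℕ, (∑ i, (m' (Sum.inl i) - m (Sum.inl i))) = N → tF G m = tF G m' →
      (monomial m 1 - monomial m' 1 : MvPolynomial (V ⊕ V) K) ∈ KI K ∅ G := by
  classical
  induction N using Nat.strong_induction_on with
  | _ N ih =>
  intro m hN hF
  have hl : ∀ i, m (Sum.inl i) + m (Sum.inr i) = m' (Sum.inl i) + m' (Sum.inr i) := fun i => by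
    rw [← tF_inl G, ← tF_inl G, hF]
  have hr := fun k => (tF_inr G m k).symm.trans ((DFunLike.congr_fun hF _).trans (tF_inr G m' k))
  by_cases hle : ∀ i, m' (Sum.inl i) ≤ m (Sum.inl i)
  · have : m = m' := by
      have h1 : ∀ i, m' (Sum.inl i) = m (Sum.inl i) := fun i => by
        have := (Finset.sum_eq_sum_iff_of_le (fun i _ => hle i)).1 (hr i).symm
        exact this i (by simp)
      ext z
      rcases z with i | i
      · exact (h1 i).symm
      · have := hl i
        have := h1 i
        omega
    simp [this]
  · push Not at hle
    obtain ⟨j, hj⟩ := hle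
    obtain ⟨i, hi, hij⟩ : ∃ i, (j = i ∨ G.Adj j i) ∧ m' (Sum.inl i) < m (Sum.inl i) := by
      by_contra hcon
      push Not at hcon
      have := Finset.sum_lt_sum (s := Finset.univ.filter (fun i => j = i ∨ G.Adj j i))
        (f := fun i => m (Sum.inl i)) (g := fun i => m' (Sum.inl i))
        (fun i hi => hcon i (by simpa using hi)) ⟨j, by simp, hj⟩
      exact absurd (hr j) this.ne
    have hne : i ≠ j := by rintro rfl; omega
    have hadj : G.Adj i j := by
      rcases hi with rfl | h
      · exact absurd rfl hne
      · exact h.symm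
    have hyj : 0 < m (Sum.inr j) := by have := hl j; omega
    obtain ⟨n, rfl⟩ : ∃ n, m = n + (Finsupp.single (Sum.inl i) 1 + Finsupp.single (Sum.inr j) 1) := by
      refine ⟨m - (Finsupp.single (Sum.inl i) 1 + Finsupp.single (Sum.inr j) 1), ?_⟩
      rw [tsub_add_cancel_of_le]
      intro z
      rcases z with k | k
      · by_cases hk : i = k
        · subst hk; simp; omega
        · simp [Finsupp.single_apply, hk]
      · by_cases hk : j = k
        · subst hk; simp; omega
        · simp [Finsupp.single_apply, hk]
    have step := ih (N - 1) ?_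
      (n + (Finsupp.single (Sum.inl j) 1 + Finsupp.single (Sum.inr i) 1)) ?_ ?_
    · have h2 : (monomial n 1 * eb K i j) ∈ KI K ∅ G :=
        Ideal.mul_mem_left _ _ (eb_mem_KI hadj)
      have h3 := Ideal.add_mem _ h2 step
      convert h3 using 1
      simp only [eb, X, mul_sub, monomial_mul, mul_one]
      ring
    · have : 0 < N := by
        rw [← hN]
        exact Finset.sum_pos' (fun _ _ => Nat.zero_le _) ⟨j, Finset.mem_univ _, by omega⟩
      omega
    · have : ∀ k, m' (Sum.inl k) - (n + (Finsupp.single (Sum.inl i) 1 + 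
          Finsupp.single (Sum.inr j) 1) : V ⊕ V →₀ ℕ) (Sum.inl k) = 
          (m' (Sum.inl k) - (n + (Finsupp.single (Sum.inl j) 1 + 
          Finsupp.single (Sum.inr i) 1) : V ⊕ V →₀ ℕ) (Sum.inl k)) + if k = j then 1 else 0 := by
        intro k
        by_cases hk : k = j
        · subst hk
          simp [Finsupp.single_apply, hne] at hj ⊢
          omega
        · by_cases hk' : k = i
          · subst hk'
            simp [Finsupp.single_apply, hne, hne.symm] at hij ⊢
            omega
          · simp [Finsupp.single_apply, hk, Ne.symm hk, Ne.symm hk']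
      rw [Finset.sum_congr rfl (fun k _ => this k), Finset.sum_add_distrib] at hN
      simp at hN
      simp
      omega
    · rw [← hF, tF_add, tF_add, tF_add, tF_add, tF_single, tF_single, tF_single, tF_single, 
        tw_swap hG hadj]

lemma mem_of_tphi {G : SimpleGraph V} (hG : Tr G) (f : MvPolynomial (V ⊕ V) K)
    (hf : tphi K G f = 0) : f ∈ KI K ∅ G := by
  let g := Function.invFun (tF G)
  let L : MvPolynomial (V ⊕ V) K →ₗ[K] MvPolynomial (V ⊕ V) K :=
    (basisMonomials (V ⊕ V) K).constr K (fun n => monomial (g n) 1)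
  have hL : ∀ n, L (monomial n 1) = monomial (g n) 1 := fun n => by
    have := (basisMonomials (V ⊕ V) K).constr_basis K (fun n => (monomial (g n) (1 : K))) n
    simpa using this
  have key : ∀ f, f - L (tphi K G f) ∈ KI K ∅ G := by
    intro f
    induction f using MvPolynomial.induction_on' with
    | monomial m c =>
      have h1 : (monomial m c : MvPolynomial (V ⊕ V) K) = c • monomial m 1 := by simp [smul_monomial]
      rw [h1, map_smul, map_smul, ← smul_sub, tphi_monomial, hL]
      refine Submodule.smul_of_tower_mem _ c ?_
      refine monomial_congr hG _ _ m rfl ?_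
      exact (Function.invFun_eq ⟨m, rfl⟩).symm
    | add p q hp hq =>
      have := Ideal.add_mem _ hp hq
      rw [map_add, map_add]
      convert this using 1
      ring
  have := key f
  rwa [hf, map_zero, sub_zero] at this

lemma tphi_of_mem {G : SimpleGraph V} (hG : Tr G) : 
    KI K ∅ G ≤ RingHom.ker (tphi K G) := by
  rw [KI_le_iff]
  refine ⟨fun z hz => hz.elim, fun i j hij => ?_⟩
  rw [RingHom.mem_ker]
  simp only [eb, map_sub, map_mul]
  simp only [tphi, aeval_X, monomial_mul, tw_swap hG hij, sub_self]

lemma regular_empty {G : SimpleGraph V} (hG : Tr G) (z : V ⊕ V) (f : MvPolynomial (V ⊕ V) K)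
    (h : X z * f ∈ KI K ∅ G) : f ∈ KI K ∅ G := by
  apply mem_of_tphi hG
  have h1 := tphi_of_mem hG h
  rw [RingHom.mem_ker] at h1
  rw [map_mul] at h1
  refine (mul_eq_zero.1 h1).resolve_left ?_
  simp [tphi]

lemma KI_mono {Z Z' : Set (V ⊕ V)} {G : SimpleGraph V} (h : Z ⊆ Z') : KI K Z G ≤ KI K Z' G :=
  KI_le_iff.2 ⟨fun _ hz => X_mem_KI (h hz), fun _ _ hij => eb_mem_KI hij⟩

lemma span_le_KI {Z : Set (V ⊕ V)} {G : SimpleGraph V} : 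
    Ideal.span (X '' Z : Set (MvPolynomial (V ⊕ V) K)) ≤ KI K Z G :=
  Ideal.span_mono Set.subset_union_left

lemma regular_KI {G : SimpleGraph V} (hG : Tr G) {Z : Set (V ⊕ V)}
    (hZ : ∀ i j, G.Adj i j → Sum.inl i ∉ Z ∧ Sum.inr i ∉ Z) {z : V ⊕ V} (hz : z ∉ Z)
    (f : MvPolynomial (V ⊕ V) K) (h : X z * f ∈ KI K Z G) : f ∈ KI K Z G := by
  have h1 : KI K Z G ≤ Ideal.comap (kill K Z) (KI K ∅ G) := by
    rw [KI_le_iff]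
    refine ⟨fun z hz => ?_, fun i j hij => ?_⟩
    · rw [Ideal.mem_comap, kill_of_mem hz]; exact zero_mem _
    · have := hZ i j hij
      have := hZ j i hij.symm
      rw [Ideal.mem_comap]
      simp only [eb, map_sub, map_mul]
      rw [kill_of_notMem, kill_of_notMem, kill_of_notMem, kill_of_notMem]
      · exact eb_mem_KI hij
      all_goals tauto
  have h2 := h1 h
  rw [Ideal.mem_comap, map_mul, kill_of_notMem hz] at h2
  have h3 := regular_empty hG z _ h2
  have h4 := sub_kill_mem Z f
  have : f = (f - kill K Z f) + kill K Z f := by ring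
  rw [this]
  exact Ideal.add_mem _ (span_le_KI h4) (KI_mono (Set.empty_subset _) h3)

end Toric
section Main

open MvPolynomial

variable {K : Type} [Field K] {V : Type}

/-- the graded maximal ideal -/
def mx (K : Type) [Field K] (V : Type) : Ideal (MvPolynomial (V ⊕ V) K) :=
  RingHom.ker (constantCoeff : MvPolynomial (V ⊕ V) K →+* K)

lemma X_mem_mx (z : V ⊕ V) : (X z : MvPolynomial (V ⊕ V) K) ∈ mx K V := by
  simp [mx, RingHom.mem_ker]

/-- delete all edges meeting `P` -/
def delP (G : SimpleGraph V) (P : V → Prop) : SimpleGraph V where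
  Adj a b := G.Adj a b ∧ ¬ P a ∧ ¬ P b
  symm := ⟨fun _ _ h => ⟨h.1.symm, h.2.2, h.2.1⟩⟩
  loopless := ⟨fun a h => G.loopless.irrefl a h.1⟩

/-- complete the neighbourhood of `v` -/
def compl_nb (G : SimpleGraph V) (v : V) : SimpleGraph V where
  Adj a b := G.Adj a b ∨ (a ≠ b ∧ G.Adj v a ∧ G.Adj v b)
  symm := ⟨fun _ _ h => h.elim (fun h => Or.inl h.symm)
    (fun h => Or.inr ⟨h.1.symm, h.2.2, h.2.1⟩)⟩
  loopless := ⟨fun a h => h.elim (fun h => G.loopless.irrefl a h) (fun h => h.1 rfl)⟩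

lemma KI_sup_X (Z : Set (V ⊕ V)) (G : SimpleGraph V) (z : V ⊕ V) :
    KI K Z G ⊔ Ideal.span {X z} = KI K (insert z Z) G := by
  apply le_antisymm
  · refine sup_le (KI_le_iff.2 ⟨fun a ha => X_mem_KI (Or.inr ha), fun i j h => eb_mem_KI h⟩) ?_
    rw [Ideal.span_singleton_le_iff_mem]
    exact X_mem_KI (Or.inl rfl)
  · refine KI_le_iff.2 ⟨?_, fun i j h => Ideal.mem_sup_left (eb_mem_KI h)⟩
    rintro a (rfl | ha)
    · exact Ideal.mem_sup_right (Ideal.mem_span_singleton_self _)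
    · exact Ideal.mem_sup_left (X_mem_KI ha)

variable [Fintype V] [DecidableEq V]

lemma base_case (N : ℕ) : ∀ (Z : Finset (V ⊕ V)) (G : SimpleGraph V) (T : Finset (V ⊕ V)),
    (Zᶜ : Finset (V ⊕ V)).card = N → Tr G →
    (∀ i j, G.Adj i j → Sum.inl i ∉ Z ∧ Sum.inr i ∉ Z) → Disjoint T Z →
    (∀ i j, G.Adj i j → Sum.inl i ∈ T → Sum.inl j ∉ T) →
    DGe (mx K V) (MvPolynomial (V ⊕ V) K ⧸ KI K (Z : Set (V ⊕ V)) G) T.card := by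
  classical
  induction N using Nat.strong_induction_on with
  | _ N ih =>
  intro Z G T hN hG hZ hTZ hT
  have hlt : ∀ Z' : Finset (V ⊕ V), Z ⊂ Z' → (Z'ᶜ : Finset (V ⊕ V)).card < N := by
    intro Z' h
    rw [← hN]
    exact Finset.card_lt_card (compl_lt_compl_iff_lt.2 h)
  by_cases hT0 : T = ∅
  · subst hT0; intro i hi; simp at hi
  have hTpos : 0 < T.card := Finset.card_pos.2 (Finset.nonempty_iff_ne_empty.2 hT0)
  by_cases hE : ∃ i j, G.Adj i j
  · obtain ⟨i, hi, j, hij⟩ : ∃ i, Sum.inl i ∉ T ∧ ∃ j, G.Adj i j := by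
      obtain ⟨i, j, hij⟩ := hE
      by_cases h : Sum.inl i ∈ T
      · exact ⟨j, hT i j hij h, i, hij.symm⟩
      · exact ⟨i, h, j, hij⟩
    have hiZ := hZ i j hij
    rw [show T.card = (T.card - 1) + 1 by omega]
    apply DGe.regular (X_mem_mx (Sum.inl i)) (regular_KI hG (by simpa using hZ) (by simpa using hiZ.1))
    -- the two pieces
    let P : V → Prop := fun a => a = i ∨ G.Adj i a
    let ZB : Finset (V ⊕ V) := Z ∪ (Finset.univ.filter P).map Function.Embedding.inl
    let GB := delP G P
    let ZA : Finset (V ⊕ V) := Z ∪ {Sum.inl i, Sum.inr i}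
    let GA := delP G (fun a => a = i)
    have hZBl : ∀ a, Sum.inl a ∈ ZB ↔ (Sum.inl a ∈ Z ∨ P a) := by intro a; simp [ZB]
    have hZBr : ∀ a, Sum.inr a ∈ ZB ↔ Sum.inr a ∈ Z := by intro a; simp [ZB]
    have hGB : Tr GB := fun a b c h1 h2 h3 => ⟨hG a b c h1.1 h2.1 h3, h1.2.1, h2.2.2⟩
    have hGA : Tr GA := fun a b c h1 h2 h3 => ⟨hG a b c h1.1 h2.1 h3, h1.2.1, h2.2.2⟩
    have hZB : ∀ a b, GB.Adj a b → Sum.inl a ∉ ZB ∧ Sum.inr a ∉ ZB := by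
      intro a b h
      rw [hZBl, hZBr]
      have := hZ a b h.1
      have := h.2.1
      tauto
    have hZA : ∀ a b, GA.Adj a b → Sum.inl a ∉ ZA ∧ Sum.inr a ∉ ZA := by
      intro a b h
      have h1 := hZ a b h.1
      have h2 : ¬ a = i := h.2.1
      simp [ZA, h1, h2]
    have hP : ∀ a b, G.Adj a b → P a → P b := by
      rintro a b h (rfl | h')
      · exact Or.inr h
      · by_cases hb : b = i
        · exact Or.inl hb
        · exact Or.inr (hG _ _ _ h' h (Ne.symm hb))
    have hIB : KI K (Z : Set (V ⊕ V)) G ⊔ Ideal.span {X (Sum.inl i)} ≤ KI K (ZB : Set (V ⊕ V)) GB := by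
      rw [KI_sup_X, KI_le_iff]
      constructor
      · rintro z (rfl | hz)
        · exact X_mem_KI (by rw [Finset.mem_coe, hZBl]; exact Or.inr (Or.inl rfl))
        · exact X_mem_KI (by simp only [ZB, Finset.coe_union]; exact Or.inl hz)
      · intro a b hab
        by_cases ha : P a
        · have hb := hP a b hab ha
          refine Ideal.sub_mem _ (Ideal.mul_mem_right _ _ (X_mem_KI ?_)) 
            (Ideal.mul_mem_right _ _ (X_mem_KI ?_))
          · rw [Finset.mem_coe, hZBl]; exact Or.inr ha
          · rw [Finset.mem_coe, hZBl]; exact Or.inr hb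
        · exact eb_mem_KI ⟨hab, ha, fun hb => ha (hP b a hab.symm hb)⟩
    refine DGe.colon (J := KI K (ZB : Set (V ⊕ V)) GB) (y := X (Sum.inr i)) ?_ ?_ ?_
    · intro a
      constructor
      · intro h
        refine regular_KI hGB (by simpa using hZB) ?_ a (hIB h)
        rw [Finset.mem_coe, hZBr]; exact hiZ.2
      · have : KI K (ZB : Set (V ⊕ V)) GB ≤ Submodule.comap (LinearMap.lsmul _ _ (X (Sum.inr i)))
            (KI K (Z : Set (V ⊕ V)) G ⊔ Ideal.span {X (Sum.inl i)}) := by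
          rw [KI_sup_X, KI_le_iff]
          constructor
          · rintro (z | z) hz
            · rw [Finset.mem_coe, hZBl] at hz
              rcases hz with hz | rfl | hz
              · exact Ideal.mul_mem_left _ _ (X_mem_KI (Or.inr hz))
              · exact Ideal.mul_mem_left _ _ (X_mem_KI (Or.inl rfl))
              · have h1 : eb K i z ∈ KI K (insert (Sum.inl i) (Z : Set (V ⊕ V))) G := eb_mem_KI hz
                have h2 : X (Sum.inl i) * X (Sum.inr z) ∈ 
                  KI K (insert (Sum.inl i) (Z : Set (V ⊕ V))) G := 
                  Ideal.mul_mem_right _ _ (X_mem_KI (Or.inl rfl))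
                have h3 := Ideal.sub_mem _ h2 h1
                rw [Submodule.mem_comap]
                convert h3 using 1
                simp only [eb, LinearMap.lsmul_apply, smul_eq_mul]
                ring
            · rw [Finset.mem_coe, hZBr] at hz
              exact Ideal.mul_mem_left _ _ (X_mem_KI (Or.inr hz))
          · intro a b hab
            exact Ideal.mul_mem_left _ _ (eb_mem_KI hab.1)
        intro h
        exact this h
    · -- piece B
      have hsub : Z ⊂ ZB := by
        refine ⟨Finset.subset_union_left, fun h => hiZ.1 (h ?_)⟩
        rw [hZBl]; exact Or.inr (Or.inl rfl)
      have := ih _ (hlt ZB hsub) ZB GB (T \ ZB) rfl hGB hZB Finset.sdiff_disjoint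
        (fun a b hab ha hb => hT a b hab.1 (Finset.mem_sdiff.1 ha).1 (Finset.mem_sdiff.1 hb).1)
      refine this.mono ?_
      have h1 : (T ∩ ZB).card ≤ 1 := by
        rw [Finset.card_le_one]
        have h2 : ∀ z ∈ T ∩ ZB, ∃ a, z = Sum.inl a ∧ P a := by
          rintro (z | z) hz
          · rw [Finset.mem_inter, hZBl] at hz
            refine ⟨z, rfl, hz.2.resolve_left (Finset.disjoint_left.1 hTZ hz.1)⟩
          · rw [Finset.mem_inter, hZBr] at hz
            exact absurd hz.2 (Finset.disjoint_left.1 hTZ hz.1)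
        intro z hz z' hz'
        obtain ⟨a, rfl, ha⟩ := h2 z hz
        obtain ⟨b, rfl, hb⟩ := h2 z' hz'
        have ha1 := (Finset.mem_inter.1 hz).1
        have hb1 := (Finset.mem_inter.1 hz').1
        by_contra hab
        have hab : a ≠ b := fun h => hab (by rw [h])
        rcases ha with rfl | ha
        · exact hi ha1
        · rcases hb with rfl | hb
          · exact hi hb1
          · exact hT a b (hG _ _ _ ha.symm hb hab) ha1 hb1
      have := Finset.card_sdiff_add_card_inter T ZB
      omega
    · -- piece A
      have hA : KI K (Z : Set (V ⊕ V)) G ⊔ Ideal.span {X (Sum.inl i)} ⊔ Ideal.span {X (Sum.inr i)}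
          = KI K (ZA : Set (V ⊕ V)) GA := by
        rw [KI_sup_X, KI_sup_X]
        have hZA' : (insert (Sum.inr i) (insert (Sum.inl i) (Z : Set (V ⊕ V)))) = (ZA : Set (V ⊕ V)) := by
          ext z; simp [ZA]; tauto
        rw [hZA']
        apply le_antisymm
        · refine KI_le_iff.2 ⟨fun z hz => X_mem_KI hz, fun a b hab => ?_⟩
          by_cases ha : a = i
          · subst ha
            exact Ideal.sub_mem _ (Ideal.mul_mem_right _ _ (X_mem_KI (by simp [ZA])))
              (Ideal.mul_mem_left _ _ (X_mem_KI (by simp [ZA])))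
          · by_cases hb : b = i
            · subst hb
              exact Ideal.sub_mem _ (Ideal.mul_mem_left _ _ (X_mem_KI (by simp [ZA])))
                (Ideal.mul_mem_right _ _ (X_mem_KI (by simp [ZA])))
            · exact eb_mem_KI ⟨hab, ha, hb⟩
        · exact KI_le_iff.2 ⟨fun z hz => X_mem_KI hz, fun a b hab => eb_mem_KI hab.1⟩
      rw [hA]
      have hsub : Z ⊂ ZA := by
        refine ⟨Finset.subset_union_left, fun h => hiZ.1 (h ?_)⟩
        simp [ZA]
      have := ih _ (hlt ZA hsub) ZA GA (T.erase (Sum.inr i)) rfl hGA hZA ?_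
        (fun a b hab ha hb => hT a b hab.1 (Finset.mem_erase.1 ha).2 (Finset.mem_erase.1 hb).2)
      · exact this.mono Finset.pred_card_le_card_erase
      · rw [Finset.disjoint_left]
        intro z hz hz'
        rw [Finset.mem_erase] at hz
        simp only [ZA, Finset.mem_union, Finset.mem_insert, Finset.mem_singleton] at hz'
        rcases hz' with h | rfl | rfl
        · exact Finset.disjoint_left.1 hTZ hz.2 h
        · exact hi hz.2
        · exact hz.1 rfl
  · obtain ⟨t, ht⟩ := Finset.nonempty_iff_ne_empty.2 hT0
    have htZ := Finset.disjoint_left.1 hTZ ht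
    rw [← Finset.card_erase_add_one ht]
    apply DGe.regular (X_mem_mx t) (regular_KI hG (by simpa using hZ) (by simpa using htZ))
    rw [KI_sup_X, ← Finset.coe_insert]
    have hE' : ∀ a b, ¬ G.Adj a b := fun a b h => hE ⟨a, b, h⟩
    apply ih _ (hlt _ (Finset.ssubset_insert htZ)) (insert t Z) G _ rfl hG
      (fun a b h => absurd h (hE' a b)) ?_ (fun a b h => absurd h (hE' a b))
    rw [Finset.disjoint_left]
    intro z hz hz'
    rw [Finset.mem_erase] at hz
    rcases Finset.mem_insert.1 hz' with h | h
    · exact hz.1 h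
    · exact Finset.disjoint_left.1 hTZ hz.2 h

/-- variables of vertices in U -/
def ZU (U : Finset V) : Finset (V ⊕ V) := Finset.univ.filter (fun z => Sum.elim id id z ∈ U)

lemma mem_ZU_inl {U : Finset V} {a : V} : Sum.inl a ∈ ZU U ↔ a ∈ U := by simp [ZU]

lemma mem_ZU_inr {U : Finset V} {a : V} : Sum.inr a ∈ ZU U ↔ a ∈ U := by simp [ZU]

lemma ohtani (U : Finset V) (G : SimpleGraph V) (v : V) (hv : v ∉ U)
    (hU : ∀ i j, G.Adj i j → i ∉ U) (f : MvPolynomial (V ⊕ V) K) :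
    f ∈ KI K (ZU U : Set (V ⊕ V)) G ↔ f ∈ KI K (ZU U : Set (V ⊕ V)) (compl_nb G v) ∧
      f ∈ KI K (ZU (insert v U) : Set (V ⊕ V)) (delP G (fun a => a = v)) := by
  set I := KI K (ZU U : Set (V ⊕ V)) G with hI
  set A := KI K (ZU U : Set (V ⊕ V)) (compl_nb G v) with hA
  set B := KI K (ZU (insert v U) : Set (V ⊕ V)) (delP G (fun a => a = v)) with hB
  let Q : Set (V ⊕ V) := {Sum.inl v, Sum.inr v}
  have hQ : ∀ a, (Sum.inl a ∈ Q ↔ a = v) ∧ (Sum.inr a ∈ Q ↔ a = v) := by intro a; simp [Q]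
  constructor
  · intro hf
    refine ⟨(KI_le_iff.2 ⟨fun z hz => X_mem_KI hz, fun a b hab => eb_mem_KI (Or.inl hab)⟩ : I ≤ A) hf,
      (KI_le_iff.2 ⟨fun z hz => X_mem_KI ?_, fun a b hab => ?_⟩ : I ≤ B) hf⟩
    · rcases z with z | z
      · rw [Finset.mem_coe, mem_ZU_inl] at hz ⊢; exact Finset.mem_insert_of_mem hz
      · rw [Finset.mem_coe, mem_ZU_inr] at hz ⊢; exact Finset.mem_insert_of_mem hz
    · have h1 : (X (Sum.inl v) : MvPolynomial (V ⊕ V) K) ∈ B := 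
        X_mem_KI (by rw [Finset.mem_coe, mem_ZU_inl]; simp)
      have h2 : (X (Sum.inr v) : MvPolynomial (V ⊕ V) K) ∈ B := 
        X_mem_KI (by rw [Finset.mem_coe, mem_ZU_inr]; simp)
      by_cases ha : a = v
      · subst ha
        exact Ideal.sub_mem _ (Ideal.mul_mem_right _ _ h1) (Ideal.mul_mem_left _ _ h2)
      · by_cases hb : b = v
        · subst hb
          exact Ideal.sub_mem _ (Ideal.mul_mem_left _ _ h2) (Ideal.mul_mem_right _ _ h1)
        · exact eb_mem_KI ⟨hab, ha, hb⟩
  · rintro ⟨hfA, hfB⟩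
    -- (1) the variables of `v` multiply A into I
    have hmul : ∀ z ∈ Q, A ≤ Submodule.comap (LinearMap.lsmul _ _ (X z)) I := by
      intro z hz
      rw [hA, KI_le_iff]
      refine ⟨fun w hw => Ideal.mul_mem_left _ _ (X_mem_KI hw), fun a b hab => ?_⟩
      rcases hab with hab | ⟨hne, ha, hb⟩
      · exact Ideal.mul_mem_left _ _ (eb_mem_KI hab)
      · have h1 : eb K v a ∈ I := eb_mem_KI ha
        have h2 : eb K v b ∈ I := eb_mem_KI hb
        rw [Submodule.mem_comap]
        rcases hz with rfl | hz
        · have h3 := Ideal.sub_mem _ (Ideal.mul_mem_left _ (X (Sum.inl a)) h2) 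
            (Ideal.mul_mem_left _ (X (Sum.inl b)) h1)
          convert h3 using 1
          simp only [eb, LinearMap.lsmul_apply, smul_eq_mul]
          ring
        · rw [Set.mem_singleton_iff] at hz
          subst hz
          have h3 := Ideal.sub_mem _ (Ideal.mul_mem_left _ (X (Sum.inr a)) h2) 
            (Ideal.mul_mem_left _ (X (Sum.inr b)) h1)
          convert h3 using 1
          simp only [eb, LinearMap.lsmul_apply, smul_eq_mul]
          ring
    have hmul2 : ∀ h : MvPolynomial (V ⊕ V) K, ∀ g ∈ A, (h - kill K Q h) * g ∈ I := by
      intro h g hg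
      have h1 : Ideal.span (X '' Q : Set (MvPolynomial (V ⊕ V) K)) ≤ 
          Submodule.comap (LinearMap.lsmul _ _ g) I := by
        rw [Ideal.span_le]
        rintro _ ⟨z, hz, rfl⟩
        have := hmul z hz hg
        rw [Submodule.mem_comap, LinearMap.lsmul_apply, smul_eq_mul] at this
        rw [SetLike.mem_coe, Submodule.mem_comap, LinearMap.lsmul_apply, smul_eq_mul, mul_comm]
        exact this
      have h2 := h1 (sub_kill_mem Q h)
      rw [Submodule.mem_comap, LinearMap.lsmul_apply, smul_eq_mul, mul_comm] at h2
      exact h2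
    have hZv : ∀ z ∈ ZU U, z ∉ Q := by
      rintro (z | z) hz hz'
      · rw [mem_ZU_inl] at hz; rw [(hQ z).1] at hz'; exact hv (hz' ▸ hz)
      · rw [mem_ZU_inr] at hz; rw [(hQ z).2] at hz'; exact hv (hz' ▸ hz)
    have hkill : ∀ a b, a ≠ v → b ≠ v → kill K Q (eb K a b) = eb K a b := by
      intro a b ha hb
      simp only [eb, map_sub, map_mul]
      rw [kill_of_notMem, kill_of_notMem, kill_of_notMem, kill_of_notMem]
      · rw [(hQ a).2]; exact ha
      · rw [(hQ b).1]; exact hb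
      · rw [(hQ b).2]; exact hb
      · rw [(hQ a).1]; exact ha
    have hkv : ∀ a b, a = v ∨ b = v → kill K Q (eb K a b) = 0 := by
      intro a b h
      simp only [eb, map_sub, map_mul]
      rcases h with rfl | rfl
      · rw [kill_of_mem (z := Sum.inl a) (by simp [Q]), kill_of_mem (z := Sum.inr a) (by simp [Q])]
        simp
      · rw [kill_of_mem (z := Sum.inl b) (by simp [Q]), kill_of_mem (z := Sum.inr b) (by simp [Q])]
        simp
    have claim1 : f - kill K Q f ∈ I := by
      refine Submodule.span_induction (p := fun g _ => g - kill K Q g ∈ I) ?_ ?_ ?_ ?_ hfA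
      · rintro g (⟨z, hz, rfl⟩ | ⟨a, b, hab, rfl⟩)
        · rw [kill_of_notMem (hZv z hz), sub_self]; exact zero_mem _
        · by_cases h : a = v ∨ b = v
          · rw [hkv a b h, sub_zero]
            rcases hab with hab | ⟨_, ha, hb⟩
            · exact eb_mem_KI hab
            · rcases h with rfl | rfl
              · exact absurd ha (G.loopless.irrefl _)
              · exact absurd hb (G.loopless.irrefl _)
          · push Not at h
            rw [hkill a b h.1 h.2, sub_self]; exact zero_mem _
      · simp
      · intro g h _ _ hg hh
        have := Ideal.add_mem _ hg hh
        rw [map_add]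
        convert this using 1
        ring
      · intro h g hg hg'
        rw [smul_eq_mul, map_mul]
        have h1 := hmul2 h g hg
        have h2 : h * g - kill K Q h * kill K Q g = 
          (h - kill K Q h) * g + kill K Q h * (g - kill K Q g) := by ring
        rw [h2]
        exact Ideal.add_mem _ h1 (Ideal.mul_mem_left _ _ hg')
    have claim2 : B ≤ Ideal.comap (kill K Q) I := by
      rw [hB, KI_le_iff]
      constructor
      · intro z hz
        rw [Ideal.mem_comap]
        by_cases hzQ : z ∈ Q
        · rw [kill_of_mem hzQ]; exact zero_mem _
        · rw [kill_of_notMem hzQ]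
          apply X_mem_KI
          rcases z with z | z
          · rw [Finset.mem_coe, mem_ZU_inl] at hz ⊢
            rw [(hQ z).1] at hzQ
            exact (Finset.mem_insert.1 hz).resolve_left hzQ
          · rw [Finset.mem_coe, mem_ZU_inr] at hz ⊢
            rw [(hQ z).2] at hzQ
            exact (Finset.mem_insert.1 hz).resolve_left hzQ
      · intro a b hab
        rw [Ideal.mem_comap, hkill a b hab.2.1 hab.2.2]
        exact eb_mem_KI hab.1
    have h2 := claim2 hfB
    rw [Ideal.mem_comap] at h2
    have : f = (f - kill K Q f) + kill K Q f := by ring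
    rw [this]
    exact Ideal.add_mem _ claim1 h2

lemma ohtani_sup (U : Finset V) (G : SimpleGraph V) (v : V) :
    KI K (ZU U : Set (V ⊕ V)) (compl_nb G v) ⊔
      KI K (ZU (insert v U) : Set (V ⊕ V)) (delP G (fun a => a = v)) =
    KI K (ZU (insert v U) : Set (V ⊕ V)) (delP (compl_nb G v) (fun a => a = v)) := by
  set C := KI K (ZU (insert v U) : Set (V ⊕ V)) (delP (compl_nb G v) (fun a => a = v)) with hC
  apply le_antisymm
  · refine sup_le ?_ ?_
    · refine KI_le_iff.2 ⟨fun z hz => X_mem_KI ?_, fun a b hab => ?_⟩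
      · rcases z with z | z
        · rw [Finset.mem_coe, mem_ZU_inl] at hz ⊢; exact Finset.mem_insert_of_mem hz
        · rw [Finset.mem_coe, mem_ZU_inr] at hz ⊢; exact Finset.mem_insert_of_mem hz
      · have h1 : (X (Sum.inl v) : MvPolynomial (V ⊕ V) K) ∈ C := 
          X_mem_KI (by rw [Finset.mem_coe, mem_ZU_inl]; simp)
        have h2 : (X (Sum.inr v) : MvPolynomial (V ⊕ V) K) ∈ C := 
          X_mem_KI (by rw [Finset.mem_coe, mem_ZU_inr]; simp)
        by_cases ha : a = v
        · subst ha
          exact Ideal.sub_mem _ (Ideal.mul_mem_right _ _ h1) (Ideal.mul_mem_left _ _ h2)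
        · by_cases hb : b = v
          · subst hb
            exact Ideal.sub_mem _ (Ideal.mul_mem_left _ _ h2) (Ideal.mul_mem_right _ _ h1)
          · exact eb_mem_KI ⟨hab, ha, hb⟩
    · exact KI_le_iff.2 ⟨fun z hz => X_mem_KI hz, fun a b hab => eb_mem_KI ⟨Or.inl hab.1, hab.2⟩⟩
  · exact KI_le_iff.2 ⟨fun z hz => Ideal.mem_sup_right (X_mem_KI hz), 
      fun a b hab => Ideal.mem_sup_left (eb_mem_KI hab.1)⟩

end Main
section Weights

open MvPolynomial

variable {K : Type} [Field K] {V : Type} [Fintype V] [DecidableEq V]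

open Classical in
/-- weight of a vertex set -/
def wt (G : SimpleGraph V) (C : Finset V) : ℕ :=
  if C = ∅ then 0 else if (∀ a ∈ C, ∀ b ∈ C, a ≠ b → G.Adj a b) then C.card + 1 else 4

lemma wt_congr {G H : SimpleGraph V} {C : Finset V}
    (h : ∀ a ∈ C, ∀ b ∈ C, (G.Adj a b ↔ H.Adj a b)) : wt G C = wt H C := by
  have : (∀ a ∈ C, ∀ b ∈ C, a ≠ b → G.Adj a b) ↔ (∀ a ∈ C, ∀ b ∈ C, a ≠ b → H.Adj a b) := by
    constructor
    · intro h' a ha b hb hab; exact (h a ha b hb).1 (h' a ha b hb hab)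
    · intro h' a ha b hb hab; exact (h a ha b hb).2 (h' a ha b hb hab)
  unfold wt
  by_cases h2 : (∀ a ∈ C, ∀ b ∈ C, a ≠ b → G.Adj a b)
  · rw [if_pos h2, if_pos (this.1 h2)]
  · rw [if_neg h2, if_neg (fun h3 => h2 (this.2 h3))]

lemma wt_eq_four {G : SimpleGraph V} {C : Finset V} {a b : V} (ha : a ∈ C) (hb : b ∈ C)
    (hab : a ≠ b) (h : ¬ G.Adj a b) : wt G C = 4 := by
  have h1 : C ≠ ∅ := Finset.ne_empty_of_mem ha
  have h2 : ¬ (∀ a ∈ C, ∀ b ∈ C, a ≠ b → G.Adj a b) := fun h' => h (h' a ha b hb hab)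
  simp only [wt, h1, h2, if_false]

lemma le_wt {G : SimpleGraph V} {C : Finset V} {k : ℕ} (hk : k ≤ 4) (h0 : 2 ≤ k) 
    (hC : k ≤ C.card + 1) : k ≤ wt G C := by
  have h1 : C ≠ ∅ := by rintro rfl; simp at hC; omega
  simp only [wt, h1, if_false]
  split_ifs <;> omega

/-- the vertices of label p outside U -/
def cls {ι : Type} [DecidableEq ι] (c : V → ι) (U : Finset V) (p : ι) : Finset V :=
  Finset.univ.filter (fun v => v ∉ U ∧ c v = p)

lemma mem_cls {ι : Type} [DecidableEq ι] {c : V → ι} {U : Finset V} {p : ι} {v : V} :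
    v ∈ cls c U p ↔ v ∉ U ∧ c v = p := by simp [cls]

open Classical in
/-- number of non-adjacent ordered pairs outside `U` -/
def nonAdj (G : SimpleGraph V) (U : Finset V) : Finset (V × V) :=
  Finset.univ.filter (fun q => q.1 ∉ U ∧ q.2 ∉ U ∧ ¬ G.Adj q.1 q.2)

lemma exists_T (G : SimpleGraph V) (C : Finset V) : ∃ T : Finset (V ⊕ V), T.card = wt G C ∧
    (∀ z ∈ T, Sum.elim id id z ∈ C) ∧
    (∀ i j, G.Adj i j → Sum.inl i ∈ T → Sum.inl j ∉ T) := by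
  by_cases h0 : C = ∅
  · exact ⟨∅, by simp [wt, h0], by simp, by simp⟩
  · by_cases h1 : (∀ a ∈ C, ∀ b ∈ C, a ≠ b → G.Adj a b)
    · obtain ⟨a, ha⟩ := Finset.nonempty_iff_ne_empty.2 h0
      refine ⟨insert (Sum.inl a) (C.map Function.Embedding.inr), ?_, ?_, ?_⟩
      · rw [Finset.card_insert_of_notMem (by simp), Finset.card_map]
        simp only [wt, h0, if_false]
        rw [if_pos h1]
      · intro z hz
        rw [Finset.mem_insert, Finset.mem_map] at hz
        rcases hz with rfl | ⟨b, hb, rfl⟩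
        · exact ha
        · exact hb
      · intro i j hij hi hj
        simp at hi hj
        subst hi; subst hj
        exact G.loopless.irrefl _ hij
    · push Not at h1
      obtain ⟨a, ha, b, hb, hab, hnab⟩ := h1
      refine ⟨{Sum.inl a, Sum.inr a, Sum.inl b, Sum.inr b}, ?_, ?_, ?_⟩
      · rw [wt_eq_four ha hb hab hnab]
        have := hab.symm
        simp [Finset.card_insert_of_notMem, hab]
      · intro z hz
        simp at hz
        rcases hz with rfl | rfl | rfl | rfl <;> assumption
      · intro i j hij hi hj
        simp at hi hj
        rcases hi with rfl | rfl <;> rcases hj with rfl | rfl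
        · exact G.loopless.irrefl _ hij
        · exact hnab hij
        · exact hnab hij.symm
        · exact G.loopless.irrefl _ hij

lemma main_ind {ι : Type} [Fintype ι] [DecidableEq ι] (c : V → ι) (N : ℕ) :
    ∀ (U : Finset V) (G : SimpleGraph V), (nonAdj G U).card = N →
    (∀ i j, G.Adj i j → i ∉ U) → (∀ i j, G.Adj i j → c i = c j) →
    DGe (mx K V) (MvPolynomial (V ⊕ V) K ⧸ KI K (ZU U : Set (V ⊕ V)) G)
      (∑ p, wt G (cls c U p)) := by
  induction N using Nat.strong_induction_on with
  | _ N ih =>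
  intro U G hN hU hc
  by_cases hint : ∃ v a b, G.Adj v a ∧ G.Adj v b ∧ a ≠ b ∧ ¬ G.Adj a b
  · obtain ⟨v, a, b, hva, hvb, hab, hnab⟩ := hint
    have hv : v ∉ U := hU v a hva
    have ha : a ∉ U := hU a v hva.symm
    have hb : b ∉ U := hU b v hvb.symm
    have hav : a ≠ v := hva.ne'
    have hbv : b ≠ v := hvb.ne'
    have hca : c a = c v := (hc v a hva).symm
    have hcb : c b = c v := (hc v b hvb).symm
    have h4 : wt G (cls c U (c v)) = 4 :=
      wt_eq_four (mem_cls.2 ⟨ha, hca⟩) (mem_cls.2 ⟨hb, hcb⟩) hab hnab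
    have hcls : ∀ p, p ≠ c v → cls c (insert v U) p = cls c U p := by
      intro p hp
      ext x
      rw [mem_cls, mem_cls, Finset.mem_insert]
      constructor
      · rintro ⟨h1, h2⟩; exact ⟨fun h => h1 (Or.inr h), h2⟩
      · rintro ⟨h1, h2⟩
        refine ⟨?_, h2⟩
        rintro (rfl | h)
        · exact hp h2.symm
        · exact h1 h
    have hadj : ∀ p, p ≠ c v → ∀ x ∈ cls c U p, ∀ y ∈ cls c U p,
        (G.Adj x y ↔ (compl_nb G v).Adj x y) := by
      intro p hp x hx y hy
      constructor
      · exact fun h => Or.inl h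
      · rintro (h | ⟨_, h, _⟩)
        · exact h
        · exact absurd ((mem_cls.1 hx).2.symm.trans (hc v x h).symm) hp
    have hdel : ∀ (H : SimpleGraph V) p, p ≠ c v → ∀ x ∈ cls c U p, ∀ y ∈ cls c U p,
        (H.Adj x y ↔ (delP H (fun a => a = v)).Adj x y) := by
      intro H p hp x hx y hy
      refine ⟨fun h => ⟨h, ?_, ?_⟩, fun h => h.1⟩
      · rintro rfl; exact hp (mem_cls.1 hx).2.symm
      · rintro rfl; exact hp (mem_cls.1 hy).2.symm
    have haC : a ∈ cls c (insert v U) (c v) := mem_cls.2 ⟨by simp [ha, hav], hca⟩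
    have hbC : b ∈ cls c (insert v U) (c v) := mem_cls.2 ⟨by simp [hb, hbv], hcb⟩
    have hUc : ∀ i j, (compl_nb G v).Adj i j → i ∉ U := by
      rintro i j (h | ⟨_, h, _⟩)
      · exact hU i j h
      · exact hU i v h.symm
    have hcc : ∀ i j, (compl_nb G v).Adj i j → c i = c j := by
      rintro i j (h | ⟨_, h, h'⟩)
      · exact hc i j h
      · exact (hc v i h).symm.trans (hc v j h')
    have hUd : ∀ (H : SimpleGraph V), (∀ i j, H.Adj i j → i ∉ U) → 
        ∀ i j, (delP H (fun a => a = v)).Adj i j → i ∉ insert v U := by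
      intro H hH i j h
      have h1 := hH i j h.1
      have h2 : ¬ i = v := h.2.1
      simp [h1, h2]
    refine DGe.inter (ohtani U G v hv hU) ?_ ?_ ?_
    · refine (ih _ ?_ U (compl_nb G v) rfl hUc hcc).mono ?_
      · rw [← hN]
        apply Finset.card_lt_card
        refine ⟨?_, ?_⟩
        · intro q hq
          simp only [nonAdj, Finset.mem_filter, Finset.mem_univ, true_and] at hq ⊢
          exact ⟨hq.1, hq.2.1, fun h => hq.2.2 (Or.inl h)⟩
        · intro h
          have h1 : (a, b) ∈ nonAdj G U := by simp [nonAdj, ha, hb, hnab]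
          have h2 := h h1
          simp only [nonAdj, Finset.mem_filter, Finset.mem_univ, true_and] at h2
          exact h2.2.2 (Or.inr ⟨hab, hva, hvb⟩)
      · refine Finset.sum_le_sum fun p _ => ?_
        by_cases hp : p = c v
        · subst hp
          rw [h4]
          refine le_wt le_rfl (by norm_num) ?_
          have h1 : ({v, a, b} : Finset V) ⊆ cls c U (c v) := by
            intro x hx
            simp at hx
            rcases hx with rfl | rfl | rfl
            · exact mem_cls.2 ⟨hv, rfl⟩
            · exact mem_cls.2 ⟨ha, hca⟩
            · exact mem_cls.2 ⟨hb, hcb⟩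
          have h2 := Finset.card_le_card h1
          rw [Finset.card_eq_three.2 ⟨v, a, b, hav.symm, hbv.symm, hab, rfl⟩] at h2
          omega
        · exact (wt_congr (hadj p hp)).le
    · refine (ih _ ?_ (insert v U) (delP G (fun a => a = v)) rfl (hUd G hU) 
        (fun i j h => hc i j h.1)).mono ?_
      · rw [← hN]
        apply Finset.card_lt_card
        refine ⟨?_, ?_⟩
        · rintro ⟨x, y⟩ hq
          simp only [nonAdj, Finset.mem_filter, Finset.mem_univ, true_and, Finset.mem_insert,
            not_or] at hq ⊢
          exact ⟨hq.1.2, hq.2.1.2, fun h => hq.2.2 ⟨h, hq.1.1, hq.2.1.1⟩⟩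
        · intro h
          have h1 : (v, v) ∈ nonAdj G U := by simp [nonAdj, hv]
          have h2 := h h1
          simp [nonAdj] at h2
      · refine Finset.sum_le_sum fun p _ => ?_
        by_cases hp : p = c v
        · subst hp
          rw [h4, wt_eq_four (G := delP G (fun a => a = v)) haC hbC hab (fun h => hnab h.1)]
        · rw [hcls p hp]
          exact (wt_congr (hdel G p hp)).le
    · rw [ohtani_sup]
      refine (ih _ ?_ (insert v U) (delP (compl_nb G v) (fun a => a = v)) rfl (hUd _ hUc) 
        (fun i j h => hcc i j h.1)).mono ?_
      · rw [← hN]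
        apply Finset.card_lt_card
        refine ⟨?_, ?_⟩
        · rintro ⟨x, y⟩ hq
          simp only [nonAdj, Finset.mem_filter, Finset.mem_univ, true_and, Finset.mem_insert,
            not_or] at hq ⊢
          exact ⟨hq.1.2, hq.2.1.2, fun h => hq.2.2 ⟨Or.inl h, hq.1.1, hq.2.1.1⟩⟩
        · intro h
          have h1 : (v, v) ∈ nonAdj G U := by simp [nonAdj, hv]
          have h2 := h h1
          simp [nonAdj] at h2
      · rw [Nat.sub_le_iff_le_add, ← Finset.add_sum_erase _ _ (Finset.mem_univ (c v)),
          ← Finset.add_sum_erase _ _ (Finset.mem_univ (c v))]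
        have h3 : 3 ≤ wt (delP (compl_nb G v) (fun a => a = v)) (cls c (insert v U) (c v)) := by
          refine le_wt (by norm_num) (by norm_num) ?_
          have h1 : ({a, b} : Finset V) ⊆ cls c (insert v U) (c v) := by
            intro x hx
            simp at hx
            rcases hx with rfl | rfl
            · exact haC
            · exact hbC
          have h2 := Finset.card_le_card h1
          rw [Finset.card_pair hab] at h2
          omega
        have h5 : ∑ p ∈ Finset.univ.erase (c v), wt G (cls c U p) ≤ 
            ∑ p ∈ Finset.univ.erase (c v), 
              wt (delP (compl_nb G v) (fun a => a = v)) (cls c (insert v U) p) := by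
          refine Finset.sum_le_sum fun p hp => ?_
          have hp := (Finset.mem_erase.1 hp).1
          rw [hcls p hp]
          exact ((wt_congr (hadj p hp)).trans (wt_congr (hdel _ p hp))).le
        rw [h4]
        omega
  · have hTr : Tr G := by
      intro i j k h1 h2 h3
      by_contra h4
      exact hint ⟨j, i, k, h1.symm, h2, h3, h4⟩
    choose T hT1 hT2 hT3 using fun p => exists_T G (cls c U p)
    have hd : ∀ p ∈ (Finset.univ : Finset ι), ∀ q ∈ (Finset.univ : Finset ι), p ≠ q → 
        Disjoint (T p) (T q) := by
      intro p _ q _ hpq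
      rw [Finset.disjoint_left]
      intro z hz hz'
      exact hpq ((mem_cls.1 (hT2 p z hz)).2.symm.trans (mem_cls.1 (hT2 q z hz')).2)
    have h1 := base_case (K := K) _ (ZU U) G (Finset.univ.biUnion T) rfl hTr ?_ ?_ ?_
    · rw [Finset.card_biUnion hd] at h1
      simpa only [hT1] using h1
    · intro i j hij
      rw [mem_ZU_inl, mem_ZU_inr]
      exact ⟨hU i j hij, hU i j hij⟩
    · rw [Finset.disjoint_left]
      intro z hz hz'
      obtain ⟨p, -, hp⟩ := Finset.mem_biUnion.1 hz
      have h2 := (mem_cls.1 (hT2 p z hp)).1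
      simp only [ZU, Finset.mem_filter] at hz'
      exact h2 hz'.2
    · intro i j hij hi hj
      obtain ⟨p, -, hp⟩ := Finset.mem_biUnion.1 hi
      obtain ⟨q, -, hq⟩ := Finset.mem_biUnion.1 hj
      have h2 : c i = p := (mem_cls.1 (hT2 p _ hp)).2
      have h3 : c j = q := (mem_cls.1 (hT2 q _ hq)).2
      have h4 : p = q := by rw [← h2, ← h3, hc i j hij]
      subst h4
      exact hT3 p i j hij hp hq

end Weights

/-- **A lower bound for the depth of binomial edge ideals.**
`depth (S/J_G) ≥ 4r + Σ_{i=1}^{n} r_i (i+1)`, where `r` is the number of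
non-complete connected components of `G` and `r_i` is the number of connected
components of `G` which are complete graphs on `i` vertices. -/
theorem depth_binomialEdgeIdeal_lower_bound
    (K : Type) [Field K] (n : ℕ) (G : SimpleGraph (Fin n)) :
    4 * Set.ncard {c : G.ConnectedComponent | ¬ IsCompleteComponent c} +
      ∑ i ∈ Finset.Icc 1 n,
        Set.ncard {c : G.ConnectedComponent |
          IsCompleteComponent c ∧ c.supp.ncard = i} * (i + 1) ≤
    quotientDepth (binomialEdgeIdeal K G) := by
  classical
  let S := MvPolynomial (Fin n ⊕ Fin n) K
  -- the set is bounded above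
  have hbdd : BddAbove {d : ℕ | ∃ rs : List S, rs.length = d ∧
      (∀ r ∈ rs, constantCoeff r = 0) ∧
      RingTheory.Sequence.IsRegular (S ⧸ binomialEdgeIdeal K G) rs} := by
    refine ⟨n + n, ?_⟩
    rintro d ⟨rs, rfl, -, h⟩
    have h1 := (length_le_supportDim rs _ h).trans (Module.supportDim_le_ringKrullDim S _)
    rw [MvPolynomial.ringKrullDim_of_isNoetherianRing] at h1
    simp at h1
    exact_mod_cast h1
  have hJm : binomialEdgeIdeal K G ≤ mx K (Fin n) := by
    rw [← KI_empty, KI_le_iff]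
    exact ⟨fun z hz => hz.elim, fun i j _ => Ideal.sub_mem _ 
      (Ideal.mul_mem_right _ _ (X_mem_mx _)) (Ideal.mul_mem_right _ _ (X_mem_mx _))⟩
  have hmx : mx K (Fin n) ≠ ⊤ := RingHom.ker_ne_top _
  have hmain := main_ind (K := K) (fun v => G.connectedComponentMk v) _ ∅ G rfl (by simp)
    (fun i j h => SimpleGraph.ConnectedComponent.sound h.reachable)
  rw [show ((ZU (∅ : Finset (Fin n)) : Finset _) : Set (Fin n ⊕ Fin n)) = ∅ by
    ext z; simp [ZU], KI_empty] at hmain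
  obtain ⟨rs, h1, h2, h3⟩ := hmain.exists_regular hJm hmx
  have hle := le_csSup hbdd ⟨rs, h1, fun r hr => by simpa [mx, RingHom.mem_ker] using h2 r hr, h3⟩
  refine le_trans (le_of_eq ?_) hle
  -- combinatorics
  have hcard : ∀ c : G.ConnectedComponent, 
      (cls (fun v => G.connectedComponentMk v) ∅ c).card = c.supp.ncard := by
    intro c
    rw [← Set.ncard_coe_finset]
    congr 1
    ext v
    simp [mem_cls]
  have hpos : ∀ c : G.ConnectedComponent, 1 ≤ c.supp.ncard ∧ c.supp.ncard ≤ n := by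
    intro c
    refine ⟨?_, ?_⟩
    · exact (Set.ncard_pos (Set.toFinite _)).2 c.nonempty_supp
    · have := Set.ncard_le_card (s := c.supp)
      simpa using this
  have hwt : ∀ c : G.ConnectedComponent, wt G (cls (fun v => G.connectedComponentMk v) ∅ c) =
      (if IsCompleteComponent c then 0 else 4) + 
      (if IsCompleteComponent c then c.supp.ncard + 1 else 0) := by
    intro c
    have h0 : cls (fun v => G.connectedComponentMk v) ∅ c ≠ ∅ := by
      intro h
      have := hcard c
      rw [h] at this
      have := (hpos c).1
      simp at *
      omega
    have hiff : (∀ a ∈ cls (fun v => G.connectedComponentMk v) ∅ c, 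
        ∀ b ∈ cls (fun v => G.connectedComponentMk v) ∅ c, a ≠ b → G.Adj a b) ↔ 
        IsCompleteComponent c := by
      simp [mem_cls, IsCompleteComponent]
    simp only [wt, h0, if_false, hiff, hcard]
    split_ifs <;> simp
  rw [Finset.sum_congr rfl (fun c _ => hwt c), Finset.sum_add_distrib]
  congr 1
  · rw [Set.ncard_eq_toFinset_card', mul_comm, ← smul_eq_mul, ← Finset.sum_const]
    rw [Finset.sum_ite, Finset.sum_const_zero, zero_add]
    congr 1
    ext c
    simp
  · have : ∀ i, Set.ncard {c : G.ConnectedComponent | IsCompleteComponent c ∧ c.supp.ncard = i} *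
        (i + 1) = ∑ c : G.ConnectedComponent, 
          if IsCompleteComponent c ∧ c.supp.ncard = i then i + 1 else 0 := by
      intro i
      rw [Set.ncard_eq_toFinset_card', ← smul_eq_mul, ← Finset.sum_const, ← Finset.sum_filter]
      congr 1
      ext c
      simp
    rw [Finset.sum_congr rfl (fun i _ => this i), Finset.sum_comm]
    refine Finset.sum_congr rfl fun c _ => ?_
    by_cases hc : IsCompleteComponent c
    · simp only [hc, true_and, if_true]
      rw [Finset.sum_ite_eq, if_pos (Finset.mem_Icc.2 (hpos c))]
    · simp [hc]

end
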